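/- arXiv:2110.06002 — 2 statements merged into one kernel-verified Lean document; each statement's English description precedes it below -/
import Mathlib

section
/- Let n ≥ 1, let N be a symmetric positive definite real n×n matrix and K a symmetric positive semidefinite real n×n matrix. Then N + K is invertible, and the matrix κ := (N + K)^{-1}(N − K) satisfies N − κᵀNκ ⪰ 0 (i.e. N − κᵀNκ is positive semidefinite). -/
open Matrix

/-- Dissipativity of the boundary damper: for `N` symmetric positive definite and
`K` symmetric positive semidefinite, `N + K` is invertible and the reflection
matrix `κ = (N + K)⁻¹ (N − K)` satisfies `N − κᵀ N κ ⪰ 0`. -/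
theorem stmt_8 (n : ℕ) (hn : 1 ≤ n)
    (N K : Matrix (Fin n) (Fin n) ℝ)
    (hN : N.PosDef) (hK : K.PosSemidef)
    (κ : Matrix (Fin n) (Fin n) ℝ) (hκ : κ = (N + K)⁻¹ * (N - K)) :
    IsUnit (N + K) ∧ (N - κᵀ * N * κ).PosSemidef := by
  have hU : IsUnit (N + K) := (hN.add_posSemidef hK).isUnit
  refine ⟨hU, ?_⟩
  have hNt : Nᵀ = N := by simpa using hN.isHermitian.eq
  have hKt : Kᵀ = K := by simpa using hK.isHermitian.eq
  have h1 : (N + K) * κ = N - K := by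
    rw [hκ, Matrix.mul_nonsing_inv_cancel_left _ _ ((Matrix.isUnit_iff_isUnit_det _).1 hU)]
  have h2 : K * (1 + κ) = N * (1 - κ) := by
    have h3 : N * κ + K * κ = N - K := by rw [← h1, add_mul]
    have h4 : K * κ = N - K - N * κ := by rw [← h3]; abel
    rw [mul_add, mul_sub, h4, mul_one, mul_one]; abel
  have hP : (1 + κ)ᵀ * K * (1 + κ) = (1 + κᵀ) * N * (1 - κ) := by
    rw [mul_assoc, h2, ← mul_assoc, transpose_add, transpose_one]
  have hQ : (1 + κ)ᵀ * K * (1 + κ) = (1 - κᵀ) * N * (1 + κ) := by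
    have := congrArg transpose hP
    simpa [transpose_mul, hNt, hKt, mul_assoc] using this
  have hE : N - κᵀ * N * κ = (1 + κ)ᵀ * K * (1 + κ) := by
    have h5 : (2 : ℝ) • (N - κᵀ * N * κ) = (2 : ℝ) • ((1 + κ)ᵀ * K * (1 + κ)) := by
      rw [two_smul, two_smul]
      nth_rewrite 1 [hP]
      rw [hQ]
      noncomm_ring
    have h6 := congrArg (fun X => (2 : ℝ)⁻¹ • X) h5
    simpa only [smul_smul, inv_mul_cancel₀ (two_ne_zero : (2:ℝ) ≠ 0), one_smul] using h6
  rw [hE]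
  rw [← conjTranspose_eq_transpose_of_trivial]
  exact hK.conjTranspose_mul_mul_same (1 + κ)
end

section
/- Let ℓ > 0, let M, C be 6×6 diagonal positive definite real matrices, D := (MC)^{-1/2}, 𝐃 := diag(−D, D), and let B: [0,ℓ] → ℝ^{12×12} be continuous. Let Q: [0,ℓ] → ℝ^{12×12} be continuously differentiable with Q(x) diagonal for every x, written Q = diag(Q₋, Q₊) with 6×6 diagonal blocks. Let ε₁, ε₂ > 0, let s₁, s₂: [0,ℓ] → ℝ be nonnegative, and let κ̃ ∈ ℝ^{6×6}. Assume: (a) Q(x) − ε₁I₁₂ + s₁(x)·x(x−ℓ)·I₁₂ ⪰ 0 for all x ∈ [0,ℓ]; (b) −Q'(x)𝐃 + Q(x)B(x) + B(x)ᵀQ(x) − ε₂I₁₂ + s₂(x)·x(x−ℓ)·I₁₂ ⪰ 0 for all x ∈ [0,ℓ]; (c) Q₊(ℓ) − Q₋(ℓ) ⪰ 0; (d) the block matrix [[I₆, κ̃],[κ̃ᵀ, Q₋(0)D]] ⪰ 0. Then Q₊(0)D is positive definite, and with κ := (Q₊(0)D)^{-1/2}κ̃ the stability conditions hold: Q(x)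 ⪰ ε₁I₁₂ ≻ 0 on [0,ℓ], −Q'(x)𝐃 + Q(x)B(x) + B(x)ᵀQ(x) ⪰ ε₂I₁₂ ≻ 0 on [0,ℓ], Q₊(ℓ) − Q₋(ℓ) ⪰ 0, and Q₋(0)D − κᵀQ₊(0)Dκ ⪰ 0. -/
open Matrix Set

open scoped ComplexOrder in
/-- The positive semidefinite square root of a positive semidefinite matrix
(the former Mathlib definition). -/
noncomputable def Matrix.PosSemidef.sqrt {n 𝕜 : Type*} [Fintype n] [RCLike 𝕜] [DecidableEq n]
    {A : Matrix n n 𝕜} (hA : A.PosSemidef) : Matrix n n 𝕜 :=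
  hA.1.eigenvectorUnitary.1 * diagonal ((↑) ∘ Real.sqrt ∘ hA.1.eigenvalues) *
  (star hA.1.eigenvectorUnitary : Matrix n n 𝕜)

theorem aux_sqrt_transpose {A : Matrix (Fin 6) (Fin 6) ℝ} (hA : A.PosSemidef) :
    hA.sqrtᵀ = hA.sqrt := by
  have h : hA.sqrtᴴ = hA.sqrt := by
    unfold Matrix.PosSemidef.sqrt
    simp only [conjTranspose_mul, star_eq_conjTranspose, conjTranspose_conjTranspose,
      diagonal_conjTranspose, Matrix.mul_assoc]
    rfl
  rwa [conjTranspose_eq_transpose_of_trivial] at h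

theorem aux_sqrt_mul {A : Matrix (Fin 6) (Fin 6) ℝ} (hA : A.PosSemidef) :
    hA.sqrt * hA.sqrt = A := by
  have hU : (star hA.1.eigenvectorUnitary : Matrix (Fin 6) (Fin 6) ℝ) *
      hA.1.eigenvectorUnitary.1 = 1 := Unitary.coe_star_mul_self _
  have hs := hA.1.spectral_theorem
  rw [Unitary.conjStarAlgAut_apply] at hs
  conv_rhs => rw [hs]
  unfold Matrix.PosSemidef.sqrt
  generalize (star hA.1.eigenvectorUnitary : Matrix (Fin 6) (Fin 6) ℝ) = V at *
  generalize hA.1.eigenvectorUnitary.1 = U at *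
  have hd : (diagonal (RCLike.ofReal ∘ Real.sqrt ∘ hA.1.eigenvalues) : Matrix (Fin 6) (Fin 6) ℝ) *
      (Matrix.diagonal (RCLike.ofReal ∘ Real.sqrt ∘ hA.1.eigenvalues) : Matrix (Fin 6) (Fin 6) ℝ) =
      Matrix.diagonal (RCLike.ofReal ∘ hA.1.eigenvalues) := by
    rw [diagonal_mul_diagonal]
    congr 1
    funext i
    simpa using Real.mul_self_sqrt (hA.eigenvalues_nonneg i)
  rw [← hd]
  simp only [Matrix.mul_assoc]
  rw [← Matrix.mul_assoc V U, hU, Matrix.one_mul]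

theorem aux_shift {S : Matrix (Fin 6 ⊕ Fin 6) (Fin 6 ⊕ Fin 6) ℝ} {ε c : ℝ} (hε : 0 < ε)
    (hc : c ≤ 0)
    (h : (S - ε • 1 + c • (1 : Matrix (Fin 6 ⊕ Fin 6) (Fin 6 ⊕ Fin 6) ℝ)).PosSemidef) :
    S.PosDef ∧ (S - ε • 1).PosSemidef := by
  have h1 : (S - ε • 1).PosSemidef := by
    have h2 : ((-c) • (1 : Matrix (Fin 6 ⊕ Fin 6) (Fin 6 ⊕ Fin 6) ℝ)).PosSemidef :=
      Matrix.PosSemidef.one.smul (by linarith)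
    have h3 := h.add h2
    rwa [neg_smul, add_neg_cancel_right] at h3
  refine ⟨?_, h1⟩
  have h2 : (ε • (1 : Matrix (Fin 6 ⊕ Fin 6) (Fin 6 ⊕ Fin 6) ℝ)).PosDef :=
    Matrix.PosDef.one.smul hε
  have h3 := h2.add_posSemidef h1
  rwa [add_sub_cancel] at h3

/-- Feasibility of the SDP constraints (with multiplier `x(x−ℓ)` and Schur
complement) implies the matrix-inequality stability conditions of the Lyapunov
theorem for the closed-loop beam. Here `ℝ¹²` is indexed by `Fin 6 ⊕ Fin 6`,
`Q = diag(Q₋, Q₊)` with `Q₋ = (Q x).toBlocks₁₁`, `Q₊ = (Q x).toBlocks₂₂`. -/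
theorem stmt_11 (ℓ : ℝ) (hℓ : 0 < ℓ)
    (M C : Matrix (Fin 6) (Fin 6) ℝ)
    (hMdiag : M.IsDiag) (hCdiag : C.IsDiag) (hM : M.PosDef) (hC : C.PosDef)
    (D : Matrix (Fin 6) (Fin 6) ℝ)
    (hD : D = Matrix.diagonal fun i => (Real.sqrt (M i i * C i i))⁻¹)
    (Dblk : Matrix (Fin 6 ⊕ Fin 6) (Fin 6 ⊕ Fin 6) ℝ)
    (hDblk : Dblk = Matrix.fromBlocks (-D) 0 0 D)
    (B : ℝ → Matrix (Fin 6 ⊕ Fin 6) (Fin 6 ⊕ Fin 6) ℝ)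
    (hBcont : ContinuousOn B (Icc 0 ℓ))
    (Q Q' : ℝ → Matrix (Fin 6 ⊕ Fin 6) (Fin 6 ⊕ Fin 6) ℝ)
    (hQdiag : ∀ x ∈ Icc (0 : ℝ) ℓ, (Q x).IsDiag)
    (hQderiv : ∀ x ∈ Icc (0 : ℝ) ℓ, ∀ i j,
      HasDerivWithinAt (fun t => Q t i j) (Q' x i j) (Icc (0 : ℝ) ℓ) x)
    (hQ'cont : ContinuousOn Q' (Icc 0 ℓ))
    (ε₁ ε₂ : ℝ) (hε₁ : 0 < ε₁) (hε₂ : 0 < ε₂)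
    (s₁ s₂ : ℝ → ℝ)
    (hs₁ : ∀ x ∈ Icc (0 : ℝ) ℓ, 0 ≤ s₁ x) (hs₂ : ∀ x ∈ Icc (0 : ℝ) ℓ, 0 ≤ s₂ x)
    (κtilde : Matrix (Fin 6) (Fin 6) ℝ)
    (ha : ∀ x ∈ Icc (0 : ℝ) ℓ,
      (Q x - ε₁ • 1 + (s₁ x * (x * (x - ℓ))) •
        (1 : Matrix (Fin 6 ⊕ Fin 6) (Fin 6 ⊕ Fin 6) ℝ)).PosSemidef)
    (hb : ∀ x ∈ Icc (0 : ℝ) ℓ,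
      (-(Q' x) * Dblk + Q x * B x + (B x)ᵀ * Q x - ε₂ • 1 + (s₂ x * (x * (x - ℓ))) •
        (1 : Matrix (Fin 6 ⊕ Fin 6) (Fin 6 ⊕ Fin 6) ℝ)).PosSemidef)
    (hc : ((Q ℓ).toBlocks₂₂ - (Q ℓ).toBlocks₁₁).PosSemidef)
    (hd : (Matrix.fromBlocks (1 : Matrix (Fin 6) (Fin 6) ℝ) κtilde
      κtildeᵀ ((Q 0).toBlocks₁₁ * D)).PosSemidef) :
    ∃ hPD : ((Q 0).toBlocks₂₂ * D).PosDef,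
      (∀ x ∈ Icc (0 : ℝ) ℓ, (Q x).PosDef ∧ (Q x - ε₁ • 1).PosSemidef) ∧
      (∀ x ∈ Icc (0 : ℝ) ℓ,
        (-(Q' x) * Dblk + Q x * B x + (B x)ᵀ * Q x).PosDef ∧
        (-(Q' x) * Dblk + Q x * B x + (B x)ᵀ * Q x - ε₂ • 1).PosSemidef) ∧
      ((Q ℓ).toBlocks₂₂ - (Q ℓ).toBlocks₁₁).PosSemidef ∧
      ((Q 0).toBlocks₁₁ * D -
        ((hPD.posSemidef.sqrt)⁻¹ * κtilde)ᵀ * ((Q 0).toBlocks₂₂ * D) *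
          ((hPD.posSemidef.sqrt)⁻¹ * κtilde)).PosSemidef := by
  have hmul : ∀ x ∈ Icc (0 : ℝ) ℓ, ∀ s : ℝ, 0 ≤ s → s * (x * (x - ℓ)) ≤ 0 := by
    intro x hx s hs
    exact mul_nonpos_of_nonneg_of_nonpos hs
      (mul_nonpos_of_nonneg_of_nonpos hx.1 (by linarith [hx.2]))
  have hA := fun x hx => aux_shift hε₁ (hmul x hx _ (hs₁ x hx)) (ha x hx)
  have hB := fun x hx => aux_shift hε₂ (hmul x hx _ (hs₂ x hx)) (hb x hx)
  have h0 : (0 : ℝ) ∈ Icc (0 : ℝ) ℓ := ⟨le_rfl, hℓ.le⟩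
  have hPD : ((Q 0).toBlocks₂₂ * D).PosDef := by
    have hdg : (Q 0).toBlocks₂₂ = diagonal fun i => Q 0 (Sum.inr i) (Sum.inr i) := by
      ext i j
      by_cases hij : i = j
      · subst hij; simp [toBlocks₂₂]
      · rw [diagonal_apply_ne _ hij]
        exact hQdiag 0 h0 (by simpa using hij)
    rw [hdg, hD, diagonal_mul_diagonal]
    refine Matrix.PosDef.diagonal fun i => ?_
    exact mul_pos (hA 0 h0).1.diag_pos
      (inv_pos.mpr (Real.sqrt_pos.mpr (mul_pos hM.diag_pos hC.diag_pos)))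
  refine ⟨hPD, hA, hB, hc, ?_⟩
  have hT := aux_sqrt_transpose hPD.posSemidef
  have hS := aux_sqrt_mul hPD.posSemidef
  generalize hPD.posSemidef.sqrt = S at *
  have hu : IsUnit S.det := by
    have h1 : S.det * S.det ≠ 0 := by
      rw [← det_mul, hS]; exact hPD.det_pos.ne'
    exact isUnit_iff_ne_zero.mpr (left_ne_zero_of_mul h1)
  have hk : (S⁻¹ * κtilde)ᵀ * ((Q 0).toBlocks₂₂ * D) * (S⁻¹ * κtilde) = κtildeᵀ * κtilde := by
    rw [← hS, transpose_mul, transpose_nonsing_inv, hT]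
    calc κtildeᵀ * S⁻¹ * (S * S) * (S⁻¹ * κtilde)
        = κtildeᵀ * ((S⁻¹ * S) * ((S * S⁻¹) * κtilde)) := by simp only [Matrix.mul_assoc]
      _ = _ := by rw [nonsing_inv_mul _ hu, mul_nonsing_inv _ hu, Matrix.one_mul, Matrix.one_mul]
  rw [hk]
  let _ : Invertible (1 : Matrix (Fin 6) (Fin 6) ℝ) := invertibleOne
  have hd2 := hd
  rw [← conjTranspose_eq_transpose_of_trivial κtilde,
    Matrix.PosDef.fromBlocks₁₁ _ _ Matrix.PosDef.one, inv_one, Matrix.mul_one,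
    conjTranspose_eq_transpose_of_trivial] at hd2
  exact hd2
end
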